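/- For the Boolean interval function Π_{[a,b]}(x₁,…,x_n) = 1 iff a ≤ Σᵢ xᵢ ≤ b, with a + b ≤ n, the broadcast computation complexity satisfies log₂[C(n+1, b+1) + C(n, a−1)] ≤ C(Π_{[a,b]}) ≤ log₂[C(n+1, b+1) + (b − a + 1)·C(n, a−1)]. -/

import Mathlib

/-- A collision-free broadcast strategy for a collocated network of `n`
nodes, each holding a block of `N` Boolean measurements.  In each slot, the
identity of the (single) transmitting node is determined by the history of
previously broadcast bits (heard by all nodes); the transmitted bit may
depend on the transmitter's own block and on the history; at the end, every
node computes the block of function values from its own block and the full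
broadcast history. -/
structure BroadcastProtocol (n N : ℕ) where
  speaker : List Bool → Fin n
  bit : Fin n → (Fin N → Bool) → List Bool → Bool
  output : Fin n → (Fin N → Bool) → List Bool → (Fin N → Bool)

/-- The history of broadcast bits after `t` slots, on input blocks `x`. -/
def BroadcastProtocol.history {n N : ℕ} (P : BroadcastProtocol n N)
    (x : Fin n → Fin N → Bool) : ℕ → List Bool
  | 0 => []
  | t + 1 =>
    let h := P.history x t
    h ++ [P.bit (P.speaker h) (x (P.speaker h)) h]

/-- After `L` broadcast bits, every node has computed `f` applied
component-wise to the block, with zero error, for every input. -/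
def BroadcastProtocol.Computes {n N : ℕ} (P : BroadcastProtocol n N)
    (L : ℕ) (f : (Fin n → Bool) → Bool) : Prop :=
  ∀ (x : Fin n → Fin N → Bool) (i : Fin n) (k : Fin N),
    P.output i (x i) (P.history x L) k = f fun j => x j k

/-- The set of achievable per-instance bit rates for zero-error block
computation of `f`; its infimum is the broadcast computation complexity
`C(f) = lim_{N→∞} min_S (worst-case total bits)/N`. -/
def rateSet (n : ℕ) (f : (Fin n → Bool) → Bool) : Set ℝ :=
  {r | ∃ (N L : ℕ) (P : BroadcastProtocol n N),
    0 < N ∧ P.Computes L f ∧ r = (L : ℝ) / N}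

/-! ### Lower bound: fooling sets -/

section FoolingSet

variable {n N : ℕ}

theorem BroadcastProtocol.length_history (P : BroadcastProtocol n N)
    (x : Fin n → Fin N → Bool) (t : ℕ) : (P.history x t).length = t := by
  induction t with
  | zero => rfl
  | succ t ih => simp [BroadcastProtocol.history, ih]

/-- The inputs producing a given history form a combinatorial rectangle. -/
theorem BroadcastProtocol.history_mix (P : BroadcastProtocol n N)
    {x y z : Fin n → Fin N → Bool} (hz : ∀ i, z i = x i ∨ z i = y i) {t : ℕ}
    (h : P.history x t = P.history y t) : P.history z t = P.history x t := by
  induction t with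
  | zero => rfl
  | succ t ih =>
    simp only [BroadcastProtocol.history] at h ⊢
    obtain ⟨h₁, h₂⟩ := List.append_inj' h rfl
    rw [ih h₁]
    rw [← h₁] at h₂
    rcases hz (P.speaker (P.history x t)) with hi | hi <;> rw [hi]
    rw [h₂]

/-- A family of inputs such that any two distinct members with the same function value can be mixed
coordinatewise into an input with a different value bounds the number of broadcast bits. -/
theorem BroadcastProtocol.Computes.card_pow_le {P : BroadcastProtocol n N} {L : ℕ}
    {f : (Fin n → Bool) → Bool} (hP : P.Computes L f) (hn : 2 ≤ n)
    {ι : Type*} [Fintype ι] (e : ι → Fin n → Bool)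
    (he : ∀ u v, u ≠ v → f (e u) = f (e v) →
      ∃ z : Fin n → Bool, (∀ i, z i = e u i ∨ z i = e v i) ∧ f z ≠ f (e u)) :
    Fintype.card ι ^ N ≤ 2 ^ L := by
  classical
  let input : (Fin N → ι) → Fin n → Fin N → Bool := fun u i k => e (u k) i
  let φ : (Fin N → ι) → List.Vector Bool L :=
    fun u => ⟨P.history (input u) L, P.length_history _ _⟩
  have hφ : Function.Injective φ := by
    intro u v huv
    have hist : P.history (input u) L = P.history (input v) L := congrArg Subtype.val huv
    by_contra hne
    obtain ⟨k, hk⟩ := Function.ne_iff.mp hne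
    by_cases hf : f (e (u k)) = f (e (v k))
    · obtain ⟨z, hz, hfz⟩ := he _ _ hk hf
      let Z : Fin n → Fin N → Bool := fun i => if z i = e (u k) i then input u i else input v i
      have hZ : ∀ i, Z i = input u i ∨ Z i = input v i := fun i => by
        by_cases h : z i = e (u k) i <;> simp [Z, h]
      have hZk : (fun j => Z j k) = z := by
        funext i
        by_cases h : z i = e (u k) i
        · simp [Z, h, input]
        · simpa [Z, h, input] using ((hz i).resolve_left h).symm
      have hout := hP Z ⟨0, by omega⟩ k
      rw [P.history_mix hZ hist, hZk] at hout
      rcases hZ ⟨0, by omega⟩ with h | h <;> rw [h] at hout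
      · exact hfz (hout.symm.trans (hP (input u) _ k))
      · rw [hist] at hout
        exact hfz ((hout.symm.trans (hP (input v) _ k)).trans hf.symm)
    · let Z : Fin n → Fin N → Bool :=
        fun i => if i = ⟨0, by omega⟩ then input u i else input v i
      have hZ : ∀ i, Z i = input u i ∨ Z i = input v i := fun i => by
        by_cases h : i = ⟨0, by omega⟩ <;> simp [Z, h]
      have h₀ := hP Z ⟨0, by omega⟩ k
      have h₁ := hP Z ⟨1, by omega⟩ k
      have hZ₀ : Z ⟨0, by omega⟩ = input u ⟨0, by omega⟩ := by simp [Z]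
      have hZ₁ : Z ⟨1, by omega⟩ = input v ⟨1, by omega⟩ := by simp [Z]
      rw [P.history_mix hZ hist, hZ₀] at h₀
      rw [P.history_mix hZ hist, hist, hZ₁] at h₁
      exact hf ((hP (input u) _ k).symm.trans
        ((h₀.trans h₁.symm).trans (hP (input v) _ k)))
  simpa using Fintype.card_le_of_injective φ hφ

end FoolingSet

/-! ### Query trees and Kraft's inequality -/

section QueryTree

variable {n N : ℕ}

/-- Once the inputs are known to lie in `S`, the block of values of `f` can be determined with `L`
further broadcast bits. -/
inductive Determinable (f : (Fin n → Bool) → Bool) : ℕ → Set (Fin n → Fin N → Bool) → Prop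
  | const {L : ℕ} {S : Set (Fin n → Fin N → Bool)} (g : Fin N → Bool)
      (h : ∀ x ∈ S, ∀ k, f (fun j => x j k) = g k) : Determinable f L S
  | query {L : ℕ} {S : Set (Fin n → Fin N → Bool)} (i : Fin n) (p : (Fin N → Bool) → Bool)
      (h : ∀ c, Determinable f L {x ∈ S | p (x i) = c}) : Determinable f (L + 1) S

theorem Determinable.mono {f : (Fin n → Bool) → Bool} {L L' : ℕ}
    {S S' : Set (Fin n → Fin N → Bool)} (h : Determinable f L S) (hL : L ≤ L') (hS : S' ⊆ S) :
    Determinable f L' S' := by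
  induction h generalizing L' S' with
  | const g h => exact .const g fun x hx => h x (hS hx)
  | @query L S i p _ ih =>
    obtain ⟨M, rfl⟩ : ∃ M, L' = M + 1 := ⟨L' - 1, by omega⟩
    exact .query i p fun c => ih c (by omega) fun x hx => ⟨hS hx.1, hx.2⟩

theorem Determinable.exists_protocol {f : (Fin n → Bool) → Bool} (hn : 0 < n) {L : ℕ}
    {S : Set (Fin n → Fin N → Bool)} (h : Determinable f L S) :
    ∃ P : BroadcastProtocol n N, ∀ x ∈ S, ∀ i k,
      P.output i (x i) (P.history x L) k = f fun j => x j k := by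
  induction h with
  | const g h =>
    exact ⟨⟨fun _ => ⟨0, hn⟩, fun _ _ _ => false, fun _ _ _ => g⟩,
      fun x hx _ k => (h x hx k).symm⟩
  | @query L S i p _ ih =>
    choose Q hQ using ih
    let P : BroadcastProtocol n N :=
      { speaker := fun h => match h with
          | [] => i
          | c :: t => (Q c).speaker t
        bit := fun j v h => match h with
          | [] => p v
          | c :: t => (Q c).bit j v t
        output := fun j v h => match h with
          | [] => fun _ => false
          | c :: t => (Q c).output j v t }
    have hist : ∀ x t, P.history x (t + 1) = p (x i) :: (Q (p (x i))).history x t := by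
      intro x t
      induction t with
      | zero => rfl
      | succ t ih =>
        rw [BroadcastProtocol.history, ih]
        rfl
    refine ⟨P, fun x hx j k => ?_⟩
    rw [hist]
    exact hQ (p (x i)) x ⟨hx, rfl⟩ j k

/-- Powers of two, each at most `2 ^ L`, with sum at most `2 ^ (L + 1)` can be divided into two
groups with sums at most `2 ^ L`. -/
theorem exists_subset_sum_two_pow_le {α : Type*} [DecidableEq α] (l : α → ℕ) (L : ℕ)
    (A : Finset α) (hl : ∀ v ∈ A, l v ≤ L) (hA : ∑ v ∈ A, 2 ^ l v ≤ 2 ^ (L + 1)) :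
    ∃ B ⊆ A, ∑ v ∈ B, 2 ^ l v ≤ 2 ^ L ∧ ∑ v ∈ A \ B, 2 ^ l v ≤ 2 ^ L := by
  induction A using Finset.induction_on_min_value l with
  | empty => exact ⟨∅, by simp⟩
  | insert v A hv hmin ih =>
    rw [Finset.sum_insert hv] at hA
    have hpos : 0 < 2 ^ l v := by positivity
    obtain ⟨B, hBA, hB, hC⟩ := ih (fun u hu => hl u (Finset.mem_insert_of_mem hu)) (by omega)
    have hvL := hl v (Finset.mem_insert_self v A)
    have key : ∀ C ⊆ A, ∑ u ∈ C, 2 ^ l u < 2 ^ L → 2 ^ l v + ∑ u ∈ C, 2 ^ l u ≤ 2 ^ L := by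
      intro C hCA hlt
      have h₁ : 2 ^ l v ∣ ∑ u ∈ C, 2 ^ l u :=
        Finset.dvd_sum fun u hu => pow_dvd_pow 2 (hmin u (hCA hu))
      have h₂ : 2 ^ l v ∣ 2 ^ L := pow_dvd_pow 2 hvL
      have := Nat.le_of_dvd (by omega) (Nat.dvd_sub h₂ h₁)
      omega
    have hsum := Finset.sum_sdiff (f := fun u => 2 ^ l u) hBA
    have hvB : v ∉ B := fun h => hv (hBA h)
    rw [pow_succ] at hA
    rcases lt_or_ge (∑ u ∈ B, 2 ^ l u) (2 ^ L) with h | h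
    · refine ⟨insert v B, Finset.insert_subset_insert v hBA, ?_, ?_⟩
      · rw [Finset.sum_insert hvB]
        exact key B hBA h
      · rwa [Finset.insert_sdiff_insert, Finset.sdiff_insert_of_notMem hv]
    · refine ⟨B, hBA.trans (Finset.subset_insert v A), hB, ?_⟩
      rw [Finset.insert_sdiff_of_notMem _ hvB,
        Finset.sum_insert fun h => hv (Finset.mem_sdiff.mp h).1]
      exact key _ Finset.sdiff_subset (by omega)

/-- Kraft's inequality: node `i` announces `g (x i)` by a prefix code whose word for `c` has length
`L - l c`. -/
theorem Determinable.of_kraft {f : (Fin n → Bool) → Bool} {α : Type*} (i : Fin n)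
    (g : (Fin N → Bool) → α) (l : α → ℕ) (L : ℕ) (S : Set (Fin n → Fin N → Bool))
    (A : Finset α) (hA : ∑ c ∈ A, 2 ^ l c ≤ 2 ^ L) (hS : ∀ x ∈ S, g (x i) ∈ A)
    (h : ∀ c ∈ A, Determinable f (l c) {x ∈ S | g (x i) = c}) : Determinable f L S := by
  classical
  have single : ∀ {L S} {A : Finset α}, ∑ c ∈ A, 2 ^ l c ≤ 2 ^ L → (∀ x ∈ S, g (x i) ∈ A) →
      (∀ c ∈ A, Determinable f (l c) {x ∈ S | g (x i) = c}) → ∀ {c}, c ∈ A → L ≤ l c →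
      Determinable f L S := by
    intro L S A hA hS h c hc hLc
    have hA' : ∀ d ∈ A, d = c := by
      intro d hd
      by_contra hdc
      have h₁ := Finset.add_sum_erase A (fun c => 2 ^ l c) hc
      have h₂ := Finset.single_le_sum (f := fun c => 2 ^ l c) (fun _ _ => Nat.zero_le _)
        (Finset.mem_erase.mpr ⟨hdc, hd⟩)
      have h₃ : 2 ^ L ≤ 2 ^ l c := Nat.pow_le_pow_right (by norm_num) hLc
      have h₄ : 0 < 2 ^ l d := by positivity
      omega
    have hcL : l c ≤ L := (Nat.pow_le_pow_iff_right (a := 2) (by norm_num)).mp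
      ((Finset.single_le_sum (f := fun c => 2 ^ l c) (fun _ _ => Nat.zero_le _) hc).trans hA)
    exact (h c hc).mono hcL fun x hx => ⟨hx, hA' _ (hS x hx)⟩
  induction L generalizing A S with
  | zero =>
    rcases A.eq_empty_or_nonempty with rfl | ⟨c, hc⟩
    · exact .const (fun _ => false) fun x hx => by simpa using hS x hx
    · exact single hA hS h hc (Nat.zero_le _)
  | succ L ih =>
    by_cases hbig : ∃ c ∈ A, L + 1 ≤ l c
    · obtain ⟨c, hc, hLc⟩ := hbig
      exact single hA hS h hc hLc
    · push Not at hbig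
      obtain ⟨B, hBA, hB, hC⟩ := exists_subset_sum_two_pow_le l L A
        (fun c hc => Nat.lt_succ_iff.mp (hbig c hc)) hA
      refine .query i (fun v => decide (g v ∈ B)) fun b => ?_
      cases b with
      | true =>
        refine ih _ B hB (fun x hx => by simpa using hx.2) fun c hc => ?_
        exact (h c (hBA hc)).mono le_rfl fun x hx => ⟨hx.1.1, hx.2⟩
      | false =>
        refine ih _ (A \ B) hC (fun x hx => ?_) fun c hc => ?_
        · exact Finset.mem_sdiff.mpr ⟨hS x hx.1, by simpa using hx.2⟩
        · exact (h c (Finset.mem_sdiff.mp hc).1).mono le_rfl fun x hx => ⟨hx.1.1, hx.2⟩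

end QueryTree

/-! ### Decision trees for a single instance -/

section DecisionTree

variable {n N : ℕ}

/-- On the inputs in `K`, the value of `f` is found by a decision tree with at most `w` leaves that
reads the coordinates in the order given by `l` until the value is determined. -/
inductive HasDecisionTree (f : (Fin n → Bool) → Bool) :
    List (Fin n) → ℕ → Set (Fin n → Bool) → Prop
  | leaf {l : List (Fin n)} {w : ℕ} {K : Set (Fin n → Bool)} (b : Bool) (hw : 1 ≤ w)
      (h : ∀ x ∈ K, f x = b) : HasDecisionTree f l w K
  | node {i : Fin n} {l : List (Fin n)} {K : Set (Fin n → Bool)} (w : Bool → ℕ)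
      (h : ∀ c, HasDecisionTree f l (w c) {x ∈ K | x i = c}) :
      HasDecisionTree f (i :: l) (w true + w false) K

theorem HasDecisionTree.one_le {f : (Fin n → Bool) → Bool} {l : List (Fin n)} {w : ℕ}
    {K : Set (Fin n → Bool)} (h : HasDecisionTree f l w K) : 1 ≤ w := by
  induction h with
  | leaf b hw h => exact hw
  | node w h ih => exact (ih true).trans (Nat.le_add_right _ _)

theorem two_pow_clog_le {m : ℕ} (hm : 0 < m) : 2 ^ Nat.clog 2 m ≤ 2 * m := by
  rcases Nat.eq_or_lt_of_le (Nat.succ_le_of_lt hm) with rfl | hm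
  · simp
  · have h := Nat.pow_pred_clog_lt_self one_lt_two hm
    have hpos := Nat.clog_pos one_lt_two hm
    obtain ⟨c, hc⟩ := Nat.exists_eq_succ_of_ne_zero hpos.ne'
    rw [hc] at h ⊢
    rw [Nat.pred_succ] at h
    rw [pow_succ]
    omega

/-- Following one decision tree per instance, the nodes can compute a block of values with a number
of bits that exceeds the logarithm of the number of combinations of leaves by at most one bit per
node. -/
theorem HasDecisionTree.determinable {f : (Fin n → Bool) → Bool} (l : List (Fin n))
    (w : Fin N → ℕ) (K : Fin N → Set (Fin n → Bool)) (h : ∀ k, HasDecisionTree f l (w k) (K k))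
    (L : ℕ) (hL : 2 ^ l.length * ∏ k, w k ≤ 2 ^ L) :
    Determinable f L {x : Fin n → Fin N → Bool | ∀ k, (fun j => x j k) ∈ K k} := by
  induction l generalizing w K L with
  | nil =>
    have hb : ∀ k, ∃ b, ∀ x ∈ K k, f x = b := fun k => by
      cases h k with
      | leaf b _ hb => exact ⟨b, hb⟩
    choose b hb using hb
    exact .const b fun x hx k => hb k _ (hx k)
  | cons i l ih =>
    have step : ∀ k, ∃ (g : Bool → Bool) (w' : Bool → ℕ),
        ∑ c ∈ Finset.univ.image g, w' c ≤ w k ∧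
          ∀ c, HasDecisionTree f l (w' c) {x ∈ K k | g (x i) = c} := by
      intro k
      generalize hw : w k = wk
      have hk := h k
      rw [hw] at hk
      cases hk with
      | leaf b hw hb =>
        refine ⟨fun _ => false, fun _ => 1, ?_, fun c => .leaf b le_rfl fun x hx => hb x hx.1⟩
        simpa [Finset.image_const] using hw
      | node w' h' => exact ⟨id, w', by simp, h'⟩
    choose g w' hw' hg using step
    let A : Finset (Fin N → Bool) := Fintype.piFinset fun k => Finset.univ.image (g k)
    refine .of_kraft i (fun v k => g k (v k))
      (fun c => Nat.clog 2 (2 ^ l.length * ∏ k, w' k (c k))) L _ A ?_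
      (fun x _ => Fintype.mem_piFinset.mpr fun k => Finset.mem_image_of_mem _ (Finset.mem_univ _))
      fun c _ => ?_
    · calc ∑ c ∈ A, 2 ^ Nat.clog 2 (2 ^ l.length * ∏ k, w' k (c k))
          ≤ ∑ c ∈ A, 2 * (2 ^ l.length * ∏ k, w' k (c k)) :=
            Finset.sum_le_sum fun c _ => two_pow_clog_le <|
              Nat.mul_pos (by positivity) (Finset.prod_pos fun k _ => (hg k (c k)).one_le)
        _ = 2 ^ (l.length + 1) * ∏ k, ∑ c ∈ Finset.univ.image (g k), w' k c := by
            rw [Finset.prod_univ_sum, Finset.mul_sum]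
            exact Finset.sum_congr rfl fun c _ => by ring
        _ ≤ 2 ^ (l.length + 1) * ∏ k, w k :=
            Nat.mul_le_mul_left _ (Finset.prod_le_prod' fun k _ => hw' k)
        _ ≤ 2 ^ L := hL
    · refine (ih (fun k => w' k (c k)) _ (fun k => hg k (c k)) _
        (Nat.le_pow_clog one_lt_two _)).mono le_rfl ?_
      exact fun x hx k => ⟨hx.1 k, congrFun hx.2 k⟩

theorem HasDecisionTree.div_mem_rateSet {f : (Fin n → Bool) → Bool} (hn : 0 < n)
    {l : List (Fin n)} {w : ℕ} (h : HasDecisionTree f l w Set.univ) (hN : 0 < N) :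
    (Nat.clog 2 (2 ^ l.length * w ^ N) : ℝ) / N ∈ rateSet n f := by
  have hdet : Determinable f (Nat.clog 2 (2 ^ l.length * w ^ N)) Set.univ :=
    (determinable l (fun _ : Fin N => w) (fun _ => Set.univ) (fun _ => h) _
      (by simpa using Nat.le_pow_clog one_lt_two _)).mono le_rfl (by simp)
  obtain ⟨P, hP⟩ := hdet.exists_protocol hn
  exact ⟨N, _, P, hN, fun x i k => hP x trivial i k, rfl⟩

theorem bddBelow_rateSet (f : (Fin n → Bool) → Bool) : BddBelow (rateSet n f) := by
  refine ⟨0, ?_⟩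
  rintro _ ⟨N, L, P, -, -, rfl⟩
  positivity

theorem HasDecisionTree.sInf_rateSet_le {f : (Fin n → Bool) → Bool} (hn : 0 < n)
    {l : List (Fin n)} {w : ℕ} (h : HasDecisionTree f l w Set.univ) :
    sInf (rateSet n f) ≤ Real.logb 2 w := by
  have hw : (0 : ℝ) < w := by exact_mod_cast h.one_le
  have hle : ∀ N : ℕ, sInf (rateSet n f) ≤ Real.logb 2 w + (l.length + 1 : ℝ) / ((N : ℝ) + 1) := by
    intro N
    refine (csInf_le (bddBelow_rateSet f) (h.div_mem_rateSet hn N.succ_pos)).trans ?_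
    have hpow : (2 : ℝ) ^ Nat.clog 2 (2 ^ l.length * w ^ (N + 1)) ≤
        2 * (2 ^ l.length * w ^ (N + 1)) := by
      exact_mod_cast two_pow_clog_le (Nat.mul_pos (by positivity) (pow_pos h.one_le _))
    have hlog := Real.logb_le_logb_of_le one_lt_two (by positivity) hpow
    rw [Real.logb_mul (by norm_num) (by positivity), Real.logb_mul (by positivity) (by positivity),
      Real.logb_pow, Real.logb_pow, Real.logb_pow,
      Real.logb_self_eq_one one_lt_two] at hlog
    rw [div_le_iff₀ (by positivity)]
    push_cast at hlog ⊢
    field_simp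
    linarith
  have hlim := (((tendsto_natCast_atTop_atTop (R := ℝ)).atTop_add
    (tendsto_const_nhds (x := (1 : ℝ)))).const_div_atTop (l.length + 1 : ℝ)).const_add
      (Real.logb 2 (w : ℝ))
  rw [add_zero] at hlim
  exact ge_of_tendsto' hlim hle

end DecisionTree

/-! ### Decision trees for interval functions -/

section Interval

variable {n : ℕ}

/-- The number of leaves of the decision tree that reads `m` bits one by one until it is known
whether their sum lies in `[a, b]`. -/
def intervalLeaves : ℕ → ℤ → ℤ → ℕ
  | 0, _, _ => 1
  | m + 1, a, b =>
    if (m + 1 : ℤ) < a ∨ b < 0 ∨ a ≤ 0 ∧ (m + 1 : ℤ) ≤ b then 1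
    else intervalLeaves m (a - 1) (b - 1) + intervalLeaves m a b

theorem one_le_intervalLeaves (m : ℕ) (a b : ℤ) : 1 ≤ intervalLeaves m a b := by
  induction m generalizing a b with
  | zero => simp [intervalLeaves]
  | succ m ih =>
    rw [intervalLeaves]
    split_ifs
    · rfl
    · exact (ih _ _).trans (Nat.le_add_left _ _)

theorem hasDecisionTree_interval (f : (Fin n → Bool) → Bool) (l : List (Fin n)) (a b : ℤ)
    (K : Set (Fin n → Bool))
    (hK : ∀ x ∈ K, f x = decide (a ≤ (l.countP x : ℤ) ∧ (l.countP x : ℤ) ≤ b)) :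
    HasDecisionTree f l (intervalLeaves l.length a b) K := by
  induction l generalizing a b K with
  | nil => exact .leaf (decide (a ≤ 0 ∧ 0 ≤ b)) le_rfl (by simpa using hK)
  | cons i l ih =>
    rw [List.length_cons, intervalLeaves]
    split_ifs with hc
    · refine .leaf (decide (a ≤ 0 ∧ (l.length + 1 : ℤ) ≤ b)) le_rfl fun x hx => ?_
      have hlen : (i :: l).countP x ≤ l.length + 1 := List.countP_le_length
      rw [hK x hx, decide_eq_decide]
      omega
    · refine .node (fun c => intervalLeaves l.length (if c then a - 1 else a)
        (if c then b - 1 else b)) fun c => ih _ _ _ fun x hx => ?_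
      rw [hK x hx.1, List.countP_cons, decide_eq_decide]
      obtain ⟨-, rfl⟩ := hx
      by_cases h : x i = true <;> simp [h]

theorem intervalLeaves_compl (m : ℕ) (a b : ℤ) :
    intervalLeaves m (m - b) (m - a) = intervalLeaves m a b := by
  induction m generalizing a b with
  | zero => rfl
  | succ m ih =>
    have h₁ := ih a b
    have h₂ := ih (a - 1) (b - 1)
    rw [intervalLeaves, intervalLeaves]
    push_cast
    rw [show (m + 1 - b - 1 : ℤ) = m - b by ring, show (m + 1 - a - 1 : ℤ) = m - a by ring,
      show (m + 1 - b : ℤ) = m - (b - 1) by ring, show (m + 1 - a : ℤ) = m - (a - 1) by ring,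
      h₁, h₂]
    split_ifs <;> omega

theorem intervalLeaves_of_nonpos (m c : ℕ) (a : ℤ) (ha : a ≤ 0) (hc : c ≤ m + 1) :
    intervalLeaves m a (c - 1) = (m + 1).choose c := by
  induction m generalizing a c with
  | zero => interval_cases c <;> simp [intervalLeaves]
  | succ m ih =>
    rw [intervalLeaves]
    rcases c with _ | c
    · simp
    rcases hc.eq_or_lt with hc | hc
    · rw [hc, if_pos (by omega), Nat.choose_self]
    · rw [if_neg (by omega), ih (c + 1) a ha (by omega), Nat.choose_succ_succ (m + 1),
        show ((c + 1 : ℕ) : ℤ) - 1 - 1 = c - 1 by push_cast; ring,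
        ih c (a - 1) (by omega) (by omega)]

theorem choose_succ_add_mul_choose_le (a d : ℕ) :
    (2 * a + d + 3).choose (a + 2) + d * (2 * a + d + 3).choose a ≤
      (d + 1) * (2 * a + d + 3).choose (a + 1) := by
  have h₁ := Nat.choose_succ_right_eq (2 * a + d + 3) (a + 1)
  have h₂ := Nat.choose_succ_right_eq (2 * a + d + 3) a
  rw [show 2 * a + d + 3 - (a + 1) = a + d + 2 by omega] at h₁
  rw [show 2 * a + d + 3 - a = a + d + 3 by omega] at h₂
  set X := (2 * a + d + 3).choose (a + 2)
  set Y := (2 * a + d + 3).choose (a + 1)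
  set Z := (2 * a + d + 3).choose a
  have h₃ : (a + 2) * Z ≤ (a + 1) * Y := by nlinarith
  have h₄ := Nat.mul_le_mul_left d h₃
  refine Nat.le_of_mul_le_mul_left (c := a + 2) ?_ (by omega)
  nlinarith

theorem intervalLeaves_le (m a d : ℕ) (h : 2 * a + d + 2 ≤ m) :
    intervalLeaves m (a + 1) (a + d + 1) ≤
      (m + 1).choose (a + d + 2) + (d + 1) * m.choose a := by
  induction m generalizing a with
  | zero => omega
  | succ m ih =>
    rw [intervalLeaves, if_neg (by omega),
      show (a + 1 - 1 : ℤ) = a by ring, show (a + d + 1 - 1 : ℤ) = a + d by ring]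
    have hcompl : m = 2 * a + d + 1 →
        intervalLeaves m (a + 1) (a + d + 1) = intervalLeaves m a (a + d) := by
      rintro rfl
      rw [← intervalLeaves_compl]
      push_cast
      ring_nf
    rcases a with _ | a
    · have h₀ := intervalLeaves_of_nonpos m (d + 1) 0 le_rfl (by omega)
      rw [show ((d + 1 : ℕ) : ℤ) - 1 = (0 : ℕ) + d by push_cast; ring] at h₀
      rw [Nat.cast_zero] at *
      rw [h₀, Nat.choose_zero_right]
      rcases (show d + 1 ≤ m by omega).eq_or_lt with hm | hm
      · rw [hcompl (by omega), h₀, ← hm,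
          Nat.choose_symm_of_eq_add (show d + 1 + 1 = d + 1 + 1 from rfl),
          Nat.choose_symm_of_eq_add (show d + 1 + 1 + 1 = 0 + d + 2 + 1 by ring)]
        simp only [Nat.choose_one_right]
        omega
      · have := ih 0 (by omega)
        rw [Nat.choose_zero_right, Nat.cast_zero] at this
        have hpascal : (m + 1 + 1).choose (d + 2) =
          (m + 1).choose (d + 1) + (m + 1).choose (d + 2) := Nat.choose_succ_succ _ _
        rw [zero_add d, zero_add (1 : ℤ)] at this ⊢
        omega
    · have h₁ := ih a (by omega)
      have hpascal := Nat.choose_succ_succ (m + 1) (a + d + 2)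
      have hpascal' := Nat.choose_succ_succ m a
      rw [Nat.succ_eq_add_one, Nat.succ_eq_add_one] at hpascal hpascal'
      rw [show (a + d + 1 : ℤ) = (a + 1 : ℕ) + d by push_cast; ring,
        show (a + 1 : ℤ) = (a + 1 : ℕ) by push_cast; ring] at h₁
      rw [show a + 1 + d + 2 = a + d + 2 + 1 by ring, hpascal, hpascal']
      rcases (show 2 * (a + 1) + d + 1 ≤ m by omega).eq_or_lt with hm | hm
      · rw [hcompl hm.symm]
        have key := choose_succ_add_mul_choose_le a d
        have e₁ : (m + 1).choose (a + d + 2) = (m + 1).choose (a + 2) :=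
          Nat.choose_symm_of_eq_add (by omega)
        have e₂ : (m + 1).choose (a + d + 2 + 1) = (m + 1).choose (a + 1) :=
          Nat.choose_symm_of_eq_add (by omega)
        have e₃ := Nat.choose_succ_succ m (a + 1)
        rw [Nat.succ_eq_add_one, Nat.succ_eq_add_one] at e₃
        rw [show 2 * a + d + 3 = m by omega] at key
        rw [e₁, e₃] at h₁
        rw [e₁, e₂, e₃, hpascal']
        nlinarith
      · have h₂ := ih (a + 1) (by omega)
        rw [show a + 1 + d + 2 = a + d + 2 + 1 by ring] at h₂
        nlinarith

theorem card_fooling (a b : ℕ) (ha : 1 ≤ a) (hab : a ≤ b) :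
    Fintype.card {s : Finset (Fin n) // s.card = a - 1 ∨ s.card = b ∨ s.card = b + 1} =
      (n + 1).choose (b + 1) + n.choose (a - 1) := by
  have hdisj {i j : ℕ} (h : i ≠ j) : Disjoint
      (Finset.univ.filter fun s : Finset (Fin n) => s.card = i)
      (Finset.univ.filter fun s : Finset (Fin n) => s.card = j) :=
    Finset.disjoint_filter.mpr fun s _ hi hj => h (hi.symm.trans hj)
  rw [Fintype.card_subtype, Finset.filter_or, Finset.filter_or, Finset.card_union_of_disjoint,
    Finset.card_union_of_disjoint (hdisj (by omega))]
  · simp only [Finset.univ_filter_card_eq, Finset.card_powersetCard, Finset.card_univ,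
      Fintype.card_fin]
    rw [Nat.choose_succ_succ, add_comm]
  · exact Finset.disjoint_union_right.mpr ⟨hdisj (by omega), hdisj (by omega)⟩

theorem exists_mix_interval_ne {a b : ℕ} (ha : 1 ≤ a) (hab : a ≤ b) {f : (Fin n → Bool) → Bool}
    (hf : ∀ s : Finset (Fin n), f (fun i => decide (i ∈ s)) = decide (a ≤ s.card ∧ s.card ≤ b))
    {s t : Finset (Fin n)} (hs : s.card = a - 1 ∨ s.card = b ∨ s.card = b + 1)
    (ht : t.card = a - 1 ∨ t.card = b ∨ t.card = b + 1) (hst : s ≠ t)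
    (hfst : f (fun i => decide (i ∈ s)) = f (fun i => decide (i ∈ t))) :
    ∃ z : Fin n → Bool, (∀ i, z i = decide (i ∈ s) ∨ z i = decide (i ∈ t)) ∧
      f z ≠ f fun i => decide (i ∈ s) := by
  suffices ∃ c, (s ∩ t).card ≤ c ∧ c ≤ (s ∪ t).card ∧
      ¬ ((a ≤ c ∧ c ≤ b) ↔ (a ≤ s.card ∧ s.card ≤ b)) by
    obtain ⟨c, hc, hc', hne⟩ := this
    obtain ⟨r, hr, hr', rfl⟩ := Finset.exists_subsuperset_card_eq
      (Finset.inter_subset_left.trans Finset.subset_union_left) hc hc'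
    refine ⟨fun i => decide (i ∈ r), fun i => ?_, ?_⟩
    · have h₁ := @hr i
      have h₂ := @hr' i
      simp only [Finset.mem_inter, Finset.mem_union, decide_eq_decide] at h₁ h₂ ⊢
      by_cases hs : i ∈ s <;> by_cases ht : i ∈ t <;> simp_all [em, em']
    · rwa [hf, hf, Ne, decide_eq_decide]
  rw [hf, hf, decide_eq_decide] at hfst
  have hcard := Finset.card_union_add_card_inter s t
  have hlt : (s ∩ t).card < (s ∪ t).card := by
    refine Finset.card_lt_card
      ((Finset.inter_subset_left.trans Finset.subset_union_left).ssubset_of_ne fun h => hst ?_)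
    rw [← Finset.inf_eq_inter, ← Finset.sup_eq_union] at h
    exact inf_eq_sup.mp h
  have hs₁ := Finset.card_le_card (Finset.inter_subset_left (s₁ := s) (s₂ := t))
  have ht₁ := Finset.card_le_card (Finset.inter_subset_right (s₁ := s) (s₂ := t))
  by_cases hsb : s.card = b
  · exact ⟨b + 1, by omega, by omega, by omega⟩
  · by_cases hst' : s.card = b + 1 ∧ t.card = b + 1
    · exact ⟨b, by omega, by omega, by omega⟩
    · exact ⟨a, by omega, by omega, by omega⟩

end Interval

/-- **Broadcast computation complexity of Boolean interval functions.**
For the Boolean interval function `Π_{[a,b]}(x₁,…,x_n) = 1` iff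
`a ≤ Σᵢ xᵢ ≤ b`, with `1 ≤ a ≤ b` and `a + b ≤ n`, the broadcast computation
complexity `C(Π_{[a,b]})` (the optimal worst-case per-instance number of bits
for zero-error block computation in a collocated network) satisfies
`log₂[(n+1 choose b+1) + (n choose a−1)] ≤ C(Π_{[a,b]})
  ≤ log₂[(n+1 choose b+1) + (b−a+1)·(n choose a−1)]`. -/
theorem interval_broadcast_complexity
    (n a b : ℕ) (hn : 0 < n) (ha : 1 ≤ a) (hab : a ≤ b) (habn : a + b ≤ n) :
    Real.logb 2 ((n + 1).choose (b + 1) + n.choose (a - 1))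
      ≤ sInf (rateSet n fun x => decide
          (a ≤ (Finset.univ.filter fun i => x i = true).card ∧
           (Finset.univ.filter fun i => x i = true).card ≤ b)) ∧
    sInf (rateSet n fun x => decide
        (a ≤ (Finset.univ.filter fun i => x i = true).card ∧
         (Finset.univ.filter fun i => x i = true).card ≤ b))
      ≤ Real.logb 2 ((n + 1).choose (b + 1) + (b - a + 1) * n.choose (a - 1)) := by
  set f : (Fin n → Bool) → Bool := fun x => decide
    (a ≤ (Finset.univ.filter fun i => x i = true).card ∧
      (Finset.univ.filter fun i => x i = true).card ≤ b) with hf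
  have htree : HasDecisionTree f (List.finRange n) (intervalLeaves n a b) Set.univ := by
    have h := hasDecisionTree_interval f (List.finRange n) a b Set.univ fun x _ => ?_
    · rwa [List.length_finRange] at h
    · have hcount : (Finset.univ.filter fun i => x i = true).card = (List.finRange n).countP x := by
        rw [List.countP_eq_length_filter]
        simp [Finset.card_def, Fin.univ_def]
      simp only [hf, hcount, Nat.cast_le]
  refine ⟨le_csInf ⟨_, htree.div_mem_rateSet hn one_pos⟩ ?_,
    (htree.sInf_rateSet_le hn).trans ?_⟩
  · rintro _ ⟨N, L, P, hN, hP, rfl⟩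
    have hcard := hP.card_pow_le (by omega)
      (fun (s : {s : Finset (Fin n) // s.card = a - 1 ∨ s.card = b ∨ s.card = b + 1}) i =>
        decide (i ∈ s.1))
      fun s t hst => exists_mix_interval_ne ha hab (fun s => by simp [hf]) s.2 t.2
        (Subtype.coe_injective.ne hst)
    rw [card_fooling a b ha hab] at hcard
    have hpos : (0 : ℝ) < (n + 1).choose (b + 1) + n.choose (a - 1) := by
      have := Nat.choose_pos (show a - 1 ≤ n by omega)
      positivity
    have hlog := Real.logb_le_logb_of_le one_lt_two (by positivity)
      (show ((n + 1).choose (b + 1) + n.choose (a - 1) : ℝ) ^ N ≤ 2 ^ L by exact_mod_cast hcard)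
    rw [Real.logb_pow, Real.logb_pow, Real.logb_self_eq_one one_lt_two, mul_one] at hlog
    rw [le_div_iff₀ (by exact_mod_cast hN)]
    linarith
  · refine Real.logb_le_logb_of_le one_lt_two (by exact_mod_cast one_le_intervalLeaves n a b) ?_
    obtain ⟨a, rfl⟩ := Nat.exists_eq_add_of_le' ha
    obtain ⟨d, rfl⟩ := Nat.exists_eq_add_of_le hab
    have h := intervalLeaves_le n a d (by omega)
    rw [show (a + d + 1 : ℤ) = ((a + 1 + d : ℕ) : ℤ) by push_cast; ring,
      show a + d + 2 = a + 1 + d + 1 by ring] at h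
    rw [Nat.add_sub_cancel]
    have h' : (intervalLeaves n (a + 1 : ℕ) (a + 1 + d : ℕ) : ℝ) ≤
        (n + 1).choose (a + 1 + d + 1) + (d + 1) * n.choose a := by exact_mod_cast h
    refine h'.trans (le_of_eq ?_)
    push_cast
    ring
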